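/- Define A : ℕ → ℚ by A_n = C(2n, n) · ∑_{k=0}^{n} C(n, k)·C(n+k, n)·C(2n+2k, n+k)·C(2n+k, 2n−k), and extend A by A_m = 0 for m < 0. Then for every integer n ≥ 1, n⁴·A_n = 4·q₁(n−1)·A_{n−1} − 16·q₂(n−2)·A_{n−2} + 1024·q₃(n−3)·A_{n−3} − 4096·(2n−7)⁴·A_{n−4}, where q₁(m) = 500m⁴ + 976m³ + 677m² + 189m + 19, q₂(m) = 3968m⁴ + 3968m³ − 1336m² − 1164m − 177, and q₃(m) = 500m⁴ + 24m³ − 37m² + 6m + 3. Equivalently, the formal power series ∑_{n≥0} A_n φⁿ is annihilated by the Picard–Fuchs operator Θ⁴ − 2²φ·q₁(Θ) + 2⁴φ²·q₂(Θ) − 2¹⁰φ³·q₃(Θ) + 2¹²φ⁴(2Θ+1)⁴ with Θ = φ·d/dφ. -/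

import Mathlib

/-- The coefficients `A_n = C(2n,n)·∑_{k=0}^n C(n,k)·C(n+k,n)·C(2n+2k,n+k)·C(2n+k,2n−k)`
of the fundamental period of the mirror family of the degree 5 pfaffian Calabi–Yau
threefold, extended by `0` to negative indices. -/
def A5 : ℤ → ℚ
  | Int.ofNat n =>
      (((2 * n).choose n : ℚ)) *
        ∑ k ∈ Finset.range (n + 1),
          ((n.choose k : ℚ)) * (((n + k).choose n : ℚ)) *
            (((2 * n + 2 * k).choose (n + k) : ℚ)) * (((2 * n + k).choose (2 * n - k) : ℚ))
  | Int.negSucc _ => 0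

/-- The summand of `A5`, with the prefactor `C(2n,n)` included. -/
def pfF (n k : ℕ) : ℚ :=
  (((2 * n).choose n : ℚ)) *
    (((n.choose k : ℚ)) * (((n + k).choose n : ℚ)) *
      (((2 * n + 2 * k).choose (n + k) : ℚ)) * (((2 * n + k).choose (2 * n - k) : ℚ)))

theorem pfF_zero {n k : ℕ} (h : n < k) : pfF n k = 0 := by
  simp [pfF, Nat.choose_eq_zero_of_lt h]

theorem pfF_closed (k m : ℕ) :
    pfF (k + m) k = (((2 * k + 2 * m).factorial : ℚ) * ((4 * k + 2 * m).factorial : ℚ) *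
      ((3 * k + 2 * m).factorial : ℚ)) /
      (((k + m).factorial : ℚ) ^ 2 * (k.factorial : ℚ) ^ 2 * (m.factorial : ℚ) *
        ((2 * k + m).factorial : ℚ) * ((k + 2 * m).factorial : ℚ) *
        ((2 * k).factorial : ℚ)) := by
  unfold pfF
  rw [Nat.cast_choose ℚ (show k + m ≤ 2 * (k + m) by omega),
    Nat.cast_choose ℚ (show k ≤ k + m by omega),
    Nat.cast_choose ℚ (show k + m ≤ k + m + k by omega),
    Nat.cast_choose ℚ (show k + m + k ≤ 2 * (k + m) + 2 * k by omega),
    Nat.cast_choose ℚ (show 2 * (k + m) - k ≤ 2 * (k + m) + k by omega)]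
  rw [show 2 * (k + m) - (k + m) = k + m by omega, show k + m - k = m by omega,
    show k + m + k - (k + m) = k by omega,
    show 2 * (k + m) + 2 * k - (k + m + k) = 2 * k + m by omega,
    show 2 * (k + m) + k - (2 * (k + m) - k) = 2 * k by omega,
    show 2 * (k + m) - k = k + 2 * m by omega,
    show 2 * (k + m) + 2 * k = 4 * k + 2 * m by omega,
    show 2 * (k + m) + k = 3 * k + 2 * m by omega,
    show 2 * (k + m) = 2 * k + 2 * m by omega,
    show k + m + k = 2 * k + m by omega]
  have h := fun a : ℕ => (Nat.cast_ne_zero (R := ℚ)).mpr (Nat.factorial_ne_zero a)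
  have h1 := h (k + m)
  have h2 := h k
  have h3 := h m
  have h4 := h (2 * k + m)
  have h5 := h (k + 2 * m)
  have h6 := h (2 * k)
  field_simp

/-- Ratio of consecutive summands in `n`. -/
theorem pfF_succ_n (n k : ℕ) :
    pfF (n + 1) k * (((n : ℚ) + 1) * ((n : ℚ) + 1 - k) * (2 * (n : ℚ) + 1 - k) *
      (2 * (n : ℚ) + 2 - k)) =
    pfF n k * (4 * (2 * (n : ℚ) + 1) * (2 * (n : ℚ) + 2 * k + 1) * (2 * (n : ℚ) + k + 1) *
      (2 * (n : ℚ) + k + 2)) := by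
  rcases Nat.lt_or_ge n k with h | h
  · rw [pfF_zero h]
    rcases Nat.lt_or_ge (n + 1) k with h' | h'
    · rw [pfF_zero h']; ring
    · obtain rfl : k = n + 1 := by omega
      push_cast; ring
  · obtain ⟨m, rfl⟩ := Nat.exists_eq_add_of_le h
    rw [add_assoc, pfF_closed, pfF_closed]
    rw [show 2 * k + 2 * (m + 1) = 2 * k + 2 * m + 1 + 1 by ring,
      show 4 * k + 2 * (m + 1) = 4 * k + 2 * m + 1 + 1 by ring,
      show 3 * k + 2 * (m + 1) = 3 * k + 2 * m + 1 + 1 by ring,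
      show k + 2 * (m + 1) = k + 2 * m + 1 + 1 by ring,
      show k + (m + 1) = k + m + 1 by ring,
      show 2 * k + (m + 1) = 2 * k + m + 1 by ring]
    simp only [Nat.factorial_succ]
    have h := fun a : ℕ => (Nat.cast_ne_zero (R := ℚ)).mpr (Nat.factorial_ne_zero a)
    have h1 := h (k + m)
    have h2 := h k
    have h3 := h m
    have h4 := h (2 * k + m)
    have h5 := h (k + 2 * m)
    have h6 := h (2 * k)
    push_cast
    have e1 : (k : ℚ) + m + 1 ≠ 0 := by positivity
    have e2 : (m : ℚ) + 1 ≠ 0 := by positivity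
    have e3 : 2 * (k : ℚ) + m + 1 ≠ 0 := by positivity
    have e4 : (k : ℚ) + 2 * m + 1 ≠ 0 := by positivity
    have e5 : (k : ℚ) + 2 * m + 1 + 1 ≠ 0 := by positivity
    rw [div_mul_eq_mul_div, div_mul_eq_mul_div, div_eq_div_iff (by positivity) (by positivity)]
    ring

/-- Ratio of consecutive summands in `k`. -/
theorem pfF_succ_k (n k : ℕ) :
    pfF n (k + 1) * (((k : ℚ) + 1) ^ 3 * (2 * (k : ℚ) + 1)) =
    pfF n k * ((2 * (n : ℚ) + 2 * k + 1) * (2 * (n : ℚ) + k + 1) * ((n : ℚ) - k) *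
      (2 * (n : ℚ) - k)) := by
  rcases Nat.lt_or_ge n (k + 1) with h | h
  · rw [pfF_zero h]
    rcases Nat.lt_or_ge n k with h' | h'
    · rw [pfF_zero h']; ring
    · obtain rfl : k = n := by omega
      ring
  · obtain ⟨m, rfl⟩ := Nat.exists_eq_add_of_le h
    rw [pfF_closed, show k + 1 + m = k + (m + 1) by ring, pfF_closed]
    rw [show 2 * (k + 1) + 2 * m = 2 * k + 2 * m + 1 + 1 by ring,
      show 2 * k + 2 * (m + 1) = 2 * k + 2 * m + 1 + 1 by ring,
      show 4 * (k + 1) + 2 * m = 4 * k + 2 * m + 1 + 1 + 1 + 1 by ring,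
      show 4 * k + 2 * (m + 1) = 4 * k + 2 * m + 1 + 1 by ring,
      show 3 * (k + 1) + 2 * m = 3 * k + 2 * m + 1 + 1 + 1 by ring,
      show 3 * k + 2 * (m + 1) = 3 * k + 2 * m + 1 + 1 by ring,
      show k + 1 + 2 * m = k + 2 * m + 1 by ring,
      show k + 2 * (m + 1) = k + 2 * m + 1 + 1 by ring,
      show k + (m + 1) = k + m + 1 by ring,
      show 2 * (k + 1) + m = 2 * k + m + 1 + 1 by ring,
      show 2 * k + (m + 1) = 2 * k + m + 1 by ring,
      show 2 * (k + 1) = 2 * k + 1 + 1 by ring]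
    simp only [Nat.factorial_succ]
    push_cast
    rw [div_mul_eq_mul_div, div_mul_eq_mul_div, div_eq_div_iff (by positivity) (by positivity)]
    ring

def pfW0 (N k : ℚ) : ℚ :=
  (N + 1) * (N + 2) * (N + 3) * (N + 4) *
  1 * (N + 1 - k) * (N + 2 - k) * (N + 3 - k) *
  (N + 4 - k) * (2 * N + 1 - k) * (2 * N + 2 - k) * (2 * N + 3 - k) *
  (2 * N + 4 - k) * (2 * N + 5 - k) * (2 * N + 6 - k) * (2 * N + 7 - k) *
  (2 * N + 8 - k)

def pfW1 (N k : ℚ) : ℚ :=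
  (N + 2) * (N + 3) * (N + 4) * 4 *
  (2 * N + 1) * (2 * N + 2 * k + 1) * (2 * N + k + 1) * (2 * N + k + 2) *
  (N + 2 - k) * (N + 3 - k) * (N + 4 - k) * (2 * N + 3 - k) *
  (2 * N + 4 - k) * (2 * N + 5 - k) * (2 * N + 6 - k) * (2 * N + 7 - k) *
  (2 * N + 8 - k)

def pfW2 (N k : ℚ) : ℚ :=
  (N + 3) * (N + 4) * 16 * (2 * N + 1) *
  (2 * N + 3) * (2 * N + 2 * k + 1) * (2 * N + 2 * k + 3) * (2 * N + k + 1) *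
  (2 * N + k + 2) * (2 * N + k + 3) * (2 * N + k + 4) * (N + 3 - k) *
  (N + 4 - k) * (2 * N + 5 - k) * (2 * N + 6 - k) * (2 * N + 7 - k) *
  (2 * N + 8 - k)

def pfW3 (N k : ℚ) : ℚ :=
  (N + 4) * 64 * (2 * N + 1) * (2 * N + 3) *
  (2 * N + 5) * (2 * N + 2 * k + 1) * (2 * N + 2 * k + 3) * (2 * N + 2 * k + 5) *
  (2 * N + k + 1) * (2 * N + k + 2) * (2 * N + k + 3) * (2 * N + k + 4) *
  (2 * N + k + 5) * (2 * N + k + 6) * (N + 4 - k) * (2 * N + 7 - k) *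
  (2 * N + 8 - k)

def pfW4 (N k : ℚ) : ℚ :=
  256 * (2 * N + 1) * (2 * N + 3) * (2 * N + 5) *
  (2 * N + 7) * (2 * N + 2 * k + 1) * (2 * N + 2 * k + 3) * (2 * N + 2 * k + 5) *
  (2 * N + 2 * k + 7) * (2 * N + k + 1) * (2 * N + k + 2) * (2 * N + k + 3) *
  (2 * N + k + 4) * (2 * N + k + 5) * (2 * N + k + 6) * (2 * N + k + 7) *
  (2 * N + k + 8)

def pfX0 (N : ℚ) : ℚ :=
    -17694720 * N ^ 12
      - 477757440 * N ^ 11 - 6330286080 * N ^ 10 - 53747712000 * N ^ 9 - 315391795200 * N ^ 8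
      - 1301719818240 * N ^ 7 - 3771674081280 * N ^ 6 - 7586832936960 * N ^ 5 - 10376537011200 * N ^ 4
      - 9312630912000 * N ^ 3 - 5160298199040 * N ^ 2 - 1575962542080 * N - 200644853760

def pfX1 (N : ℚ) : ℚ :=
    1015021568 * N ^ 14 + 31973179392 * N ^ 13 + 456988295168 * N ^ 12
      + 3921744494592 * N ^ 11 + 22537298542592 * N ^ 10 + 91594273406976 * N ^ 9 + 271043293069312 * N ^ 8
      + 592357875425280 * N ^ 7 + 959330962819072 * N ^ 6 + 1143833357546496 * N ^ 5 + 986257011558400 * N ^ 4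
      + 594409718873088 * N ^ 3 + 235587984947712 * N ^ 2 + 54631854065664 * N + 5562054770688

def pfX2 (N : ℚ) : ℚ :=
    -4060086272 * N ^ 14 - 127892717568 * N ^ 13 - 1823022776320 * N ^ 12
      - 15553857060864 * N ^ 11 - 88536020385792 * N ^ 10 - 354791253786624 * N ^ 9 - 1029347633520640 * N ^ 8
      - 2189784486223872 * N ^ 7 - 3420726160345088 * N ^ 6 - 3889343221042176 * N ^ 5 - 3153193935330816 * N ^ 4
      - 1756773062396928 * N ^ 3 - 630709460371200 * N ^ 2 - 129242399482368 * N - 11259433654272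

def pfX3 (N : ℚ) : ℚ :=
    -17977835520 * N ^ 12
      - 485401559040 * N ^ 11 - 5847202922496 * N ^ 10 - 41459401359360 * N ^ 9 - 192233666969600 * N ^ 8
      - 612383485132800 * N ^ 7 - 1370336093546496 * N ^ 6 - 2163561404709888 * N ^ 5 - 2384189293942272 * N ^ 4
      - 1782133642407168 * N ^ 3 - 854526130496512 * N ^ 2 - 235075940216064 * N - 27969935422464

def pfX4 (N : ℚ) : ℚ :=
    536870912 * N ^ 12
      + 14495514624 * N ^ 11 + 147565576192 * N ^ 10 + 629495562240 * N ^ 9 - 238606163968 * N ^ 8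
      - 15393885143040 * N ^ 7 - 79156393740288 * N ^ 6 - 217454021784576 * N ^ 5 - 369068089573376 * N ^ 4
      - 395523376549632 * N ^ 3 - 258739196690688 * N ^ 2 - 93381799539456 * N - 14056626945024

def pfX5 (N : ℚ) : ℚ :=
    1638924288 * N ^ 10 + 36875796480 * N ^ 9 + 347203207168 * N ^ 8
      + 1769248456704 * N ^ 7 + 5212431624192 * N ^ 6 + 8482143992832 * N ^ 5 + 5215931404800 * N ^ 4
      - 5325400035072 * N ^ 3 - 11744809706752 * N ^ 2 - 7587767554560 * N - 1653192898560

def pfX6 (N : ℚ) : ℚ :=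
    114819072 * N ^ 10 + 2583429120 * N ^ 9 + 26207092736 * N ^ 8
      + 157841031168 * N ^ 7 + 620349093888 * N ^ 6 + 1637072778240 * N ^ 5 + 2875161321984 * N ^ 4
      + 3233001606912 * N ^ 3 + 2158975667200 * N ^ 2 + 741174220800 * N + 97872076800

def pfX7 (N : ℚ) : ℚ :=
    353959936 * N ^ 8
      + 6371278848 * N ^ 7 + 48518725632 * N ^ 6 + 203438407680 * N ^ 5 + 511222711296 * N ^ 4
      + 783017763840 * N ^ 3 + 707279981312 * N ^ 2 + 340847684352 * N + 65177385984

def pfX8 (N : ℚ) : ℚ :=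
    -28180480 * N ^ 8
      - 507248640 * N ^ 7 - 3807977472 * N ^ 6 - 15456448512 * N ^ 5 - 36758704128 * N ^ 4
      - 51844119552 * N ^ 3 - 41841787904 * N ^ 2 - 17705684736 * N - 3002858496

def pfX9 (N : ℚ) : ℚ :=
    16121856 * N ^ 6 + 217645056 * N ^ 5 + 1171771392 * N ^ 4
      + 3200421888 * N ^ 3 + 4619430912 * N ^ 2 + 3257846784 * N + 807432192

def pfX10 (N : ℚ) : ℚ :=
    -3276800 * N ^ 6 - 44236800 * N ^ 5 - 237461504 * N ^ 4
      - 644161536 * N ^ 3 - 918560768 * N ^ 2 - 634696704 * N - 154718208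

def pfX (N k : ℚ) : ℚ :=
  pfX0 N * k ^ 0 +
  pfX1 N * k ^ 1 +
  pfX2 N * k ^ 2 +
  pfX3 N * k ^ 3 +
  pfX4 N * k ^ 4 +
  pfX5 N * k ^ 5 +
  pfX6 N * k ^ 6 +
  pfX7 N * k ^ 7 +
  pfX8 N * k ^ 8 +
  pfX9 N * k ^ 9 +
  pfX10 N * k ^ 10

def pfQ (N k : ℚ) : ℚ :=
  (2 * N + 2 * k + 1) * (2 * N + k + 1) * (N + 4 - k) * (2 * N + 8 - k)

def pfR (k : ℚ) : ℚ := k ^ 3 * (2 * k - 1)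

def pfP (N k : ℚ) : ℚ :=
  (N + 4) ^ 4 * pfW4 N k
    - 4 * (500 * (N + 3) ^ 4 + 976 * (N + 3) ^ 3 + 677 * (N + 3) ^ 2 + 189 * (N + 3) + 19) *
      pfW3 N k
    + 16 * (3968 * (N + 2) ^ 4 + 3968 * (N + 2) ^ 3 - 1336 * (N + 2) ^ 2 - 1164 * (N + 2) - 177) *
      pfW2 N k
    - 1024 * (500 * (N + 1) ^ 4 + 24 * (N + 1) ^ 3 - 37 * (N + 1) ^ 2 + 6 * (N + 1) + 3) *
      pfW1 N k
    + 4096 * (2 * N + 1) ^ 4 * pfW0 N k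

set_option maxHeartbeats 4000000 in
set_option maxRecDepth 100000 in
/-- The Zeilberger certificate identity. -/
theorem pf_cert (N k : ℚ) :
    pfP N k = pfQ N k * pfX N (k + 1) - pfR k * pfX N k := by
  simp only [pfP, pfQ, pfR, pfX, pfX0, pfX1, pfX2, pfX3, pfX4, pfX5, pfX6, pfX7, pfX8, pfX9,
    pfX10, pfW0, pfW1, pfW2, pfW3, pfW4]
  ring

def pff (N : ℚ) : ℚ := (N + 1) * (N + 2) * (N + 3) * (N + 4)

def pft (N k : ℕ) : ℚ := pff N * pfF (N + 4) k / pfW4 N k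

theorem pfW4_pos (N k : ℕ) : 0 < pfW4 N k := by
  unfold pfW4; positivity

theorem pft4 (N k : ℕ) : pff N * pfF (N + 4) k = pfW4 N k * pft N k := by
  have := (pfW4_pos N k).ne'
  unfold pft; field_simp

theorem pft_down {a b c d w w' t f : ℚ} (hd : d ≠ 0) (h : a * c = b * d) (ha : f * a = w * t)
    (hw : w * c = w' * d) : f * b = w' * t := by
  apply mul_right_cancel₀ hd
  linear_combination (-f) * h + c * ha + t * hw

theorem pft3 (N k : ℕ) : pff N * pfF (N + 3) k = pfW3 N k * pft N k := by
  refine pft_down ?_ (pfF_succ_n (N + 3) k) (pft4 N k) ?_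
  · positivity
  · simp only [pfW3, pfW4]; push_cast; ring

theorem pft2 (N k : ℕ) : pff N * pfF (N + 2) k = pfW2 N k * pft N k := by
  refine pft_down ?_ (pfF_succ_n (N + 2) k) (pft3 N k) ?_
  · positivity
  · simp only [pfW2, pfW3]; push_cast; ring

theorem pft1 (N k : ℕ) : pff N * pfF (N + 1) k = pfW1 N k * pft N k := by
  refine pft_down ?_ (pfF_succ_n (N + 1) k) (pft2 N k) ?_
  · positivity
  · simp only [pfW1, pfW2]; push_cast; ring

theorem pft0 (N k : ℕ) : pff N * pfF N k = pfW0 N k * pft N k := by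
  refine pft_down ?_ (pfF_succ_n N k) (pft1 N k) ?_
  · positivity
  · simp only [pfW0, pfW1]; push_cast; ring

theorem pft_succ (N k : ℕ) : pft N (k + 1) * pfR ((k : ℚ) + 1) = pft N k * pfQ N k := by
  have h := pfF_succ_k (N + 4) k
  have h1 := pft4 N k
  have h2 := pft4 N (k + 1)
  -- common part of the two denominators
  have hc : ((2 * (N : ℚ) + 2 * k + 9) * (2 * (N : ℚ) + k + 9)) * pfW4 N k =
      ((2 * (N : ℚ) + 2 * k + 1) * (2 * (N : ℚ) + k + 1)) * pfW4 N ((k + 1 : ℕ) : ℚ) := by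
    simp only [pfW4]; push_cast; ring
  apply mul_left_cancel₀ (pfW4_pos N (k + 1)).ne'
  have hp : (2 * (N : ℚ) + 2 * k + 1) * (2 * (N : ℚ) + k + 1) ≠ 0 := by positivity
  apply mul_left_cancel₀ hp
  simp only [pfR, pfQ]
  push_cast at h hc h2 ⊢
  generalize pfW4 (N : ℚ) ((k : ℚ) + 1) = w' at *
  generalize pfW4 (N : ℚ) (k : ℚ) = w at *
  generalize pft N (k + 1) = t' at *
  generalize pft N k = t at *
  generalize pfF (N + 4) (k + 1) = F' at *
  generalize pfF (N + 4) k = F at *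
  generalize pff (N : ℚ) = f at *
  generalize (N : ℚ) = n at *
  generalize (k : ℚ) = x at *
  linear_combination (2 * n + 2 * x + 1) * (2 * n + x + 1) *
    (-((x + 1) ^ 3 * (2 * x + 1)) * h2 + f * h
      + (2 * n + 2 * x + 9) * (2 * n + x + 9) * (n + 4 - x) * (2 * n + 8 - x) * h1
      + t * (n + 4 - x) * (2 * n + 8 - x) * hc)

theorem pf_tele (N m : ℕ) :
    ∑ k ∈ Finset.range m, pfP N k * pft N k = pfR m * pfX N m * pft N m := by
  induction m with
  | zero => simp [pfR]
  | succ m ih =>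
    rw [Finset.sum_range_succ, ih, pf_cert]
    have := pft_succ N m
    push_cast
    linear_combination (-pfX N ((m : ℚ) + 1)) * this

def pfS (n : ℕ) : ℚ := ∑ k ∈ Finset.range (n + 1), pfF n k

theorem A5_eq (n : ℕ) : A5 (n : ℤ) = pfS n := by
  change A5 (Int.ofNat n) = _
  simp only [A5, pfS, pfF, Finset.mul_sum]

theorem pfS_ext (n M : ℕ) (h : n + 1 ≤ M) : pfS n = ∑ k ∈ Finset.range M, pfF n k := by
  unfold pfS
  apply Finset.sum_subset
  · intro x hx; simp only [Finset.mem_range] at *; omega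
  · intro x _ hx
    apply pfF_zero
    simp only [Finset.mem_range] at hx; omega

theorem pf_main (N : ℕ) :
    ((N : ℚ) + 4) ^ 4 * pfS (N + 4)
    - 4 * (500 * ((N : ℚ) + 3) ^ 4 + 976 * ((N : ℚ) + 3) ^ 3 + 677 * ((N : ℚ) + 3) ^ 2
        + 189 * ((N : ℚ) + 3) + 19) * pfS (N + 3)
    + 16 * (3968 * ((N : ℚ) + 2) ^ 4 + 3968 * ((N : ℚ) + 2) ^ 3 - 1336 * ((N : ℚ) + 2) ^ 2
        - 1164 * ((N : ℚ) + 2) - 177) * pfS (N + 2)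
    - 1024 * (500 * ((N : ℚ) + 1) ^ 4 + 24 * ((N : ℚ) + 1) ^ 3 - 37 * ((N : ℚ) + 1) ^ 2
        + 6 * ((N : ℚ) + 1) + 3) * pfS (N + 1)
    + 4096 * (2 * (N : ℚ) + 1) ^ 4 * pfS N = 0 := by
  have hf : pff N ≠ 0 := by unfold pff; positivity
  apply mul_left_cancel₀ hf
  have ht : pft N (N + 5) = 0 := by
    unfold pft; rw [pfF_zero (by omega)]; simp
  have h := pf_tele N (N + 5)
  rw [ht, mul_zero] at h
  rw [mul_zero, ← h, pfS_ext (N + 4) (N + 5) (by omega), pfS_ext (N + 3) (N + 5) (by omega),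
    pfS_ext (N + 2) (N + 5) (by omega), pfS_ext (N + 1) (N + 5) (by omega),
    pfS_ext N (N + 5) (by omega)]
  simp only [Finset.mul_sum, ← Finset.sum_add_distrib, ← Finset.sum_sub_distrib]
  apply Finset.sum_congr rfl
  intro k _
  have h4 := pft4 N k
  have h3 := pft3 N k
  have h2 := pft2 N k
  have h1 := pft1 N k
  have h0 := pft0 N k
  unfold pfP
  linear_combination ((N : ℚ) + 4) ^ 4 * h4
    - 4 * (500 * ((N : ℚ) + 3) ^ 4 + 976 * ((N : ℚ) + 3) ^ 3 + 677 * ((N : ℚ) + 3) ^ 2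
        + 189 * ((N : ℚ) + 3) + 19) * h3
    + 16 * (3968 * ((N : ℚ) + 2) ^ 4 + 3968 * ((N : ℚ) + 2) ^ 3 - 1336 * ((N : ℚ) + 2) ^ 2
        - 1164 * ((N : ℚ) + 2) - 177) * h2
    - 1024 * (500 * ((N : ℚ) + 1) ^ 4 + 24 * ((N : ℚ) + 1) ^ 3 - 37 * ((N : ℚ) + 1) ^ 2
        + 6 * ((N : ℚ) + 1) + 3) * h1
    + 4096 * (2 * (N : ℚ) + 1) ^ 4 * h0

theorem A5_neg (n : ℕ) : A5 (-((n : ℤ) + 1)) = 0 := by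
  rw [← Int.negSucc_eq]; rfl

theorem A5_vals : A5 0 = 1 ∧ A5 1 = 76 ∧ A5 2 = 45036 ∧ A5 3 = 41983600 := by
  refine ⟨(A5_eq 0).trans ?_, (A5_eq 1).trans ?_, (A5_eq 2).trans ?_, (A5_eq 3).trans ?_⟩ <;>
    simp [pfS, pfF, Finset.sum_range_succ, Nat.choose] <;> norm_num

/-- The coefficients of the fundamental period of the degree 5 pfaffian mirror family
satisfy the recurrence coming from the Picard–Fuchs operator
`Θ⁴ − 2²φ·q₁(Θ) + 2⁴φ²·q₂(Θ) − 2¹⁰φ³·q₃(Θ) + 2¹²φ⁴(2Θ+1)⁴`. -/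
theorem A5_recurrence (n : ℤ) (hn : 1 ≤ n) :
    (n : ℚ) ^ 4 * A5 n =
      4 * (500 * ((n : ℚ) - 1) ^ 4 + 976 * ((n : ℚ) - 1) ^ 3 +
          677 * ((n : ℚ) - 1) ^ 2 + 189 * ((n : ℚ) - 1) + 19) * A5 (n - 1)
        - 16 * (3968 * ((n : ℚ) - 2) ^ 4 + 3968 * ((n : ℚ) - 2) ^ 3 -
            1336 * ((n : ℚ) - 2) ^ 2 - 1164 * ((n : ℚ) - 2) - 177) * A5 (n - 2)
        + 1024 * (500 * ((n : ℚ) - 3) ^ 4 + 24 * ((n : ℚ) - 3) ^ 3 -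
            37 * ((n : ℚ) - 3) ^ 2 + 6 * ((n : ℚ) - 3) + 3) * A5 (n - 3)
        - 4096 * (2 * (n : ℚ) - 7) ^ 4 * A5 (n - 4) := by
  obtain ⟨v0, v1, v2, v3⟩ := A5_vals
  have n1 : A5 (-1) = 0 := A5_neg 0
  have n2 : A5 (-2) = 0 := A5_neg 1
  have n3 : A5 (-3) = 0 := A5_neg 2
  rcases lt_or_ge n 4 with h | h
  · interval_cases n <;> norm_num [v0, v1, v2, v3, n1, n2, n3]
  · obtain ⟨N, rfl⟩ : ∃ N : ℕ, n = (N : ℤ) + 4 := ⟨(n - 4).toNat, by omega⟩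
    have e4 : A5 ((N : ℤ) + 4) = pfS (N + 4) := by rw [← A5_eq]; push_cast; rfl
    have e3 : A5 ((N : ℤ) + 4 - 1) = pfS (N + 3) := by
      rw [← A5_eq]; congr 1; push_cast; ring
    have e2 : A5 ((N : ℤ) + 4 - 2) = pfS (N + 2) := by
      rw [← A5_eq]; congr 1; push_cast; ring
    have e1 : A5 ((N : ℤ) + 4 - 3) = pfS (N + 1) := by
      rw [← A5_eq]; congr 1; push_cast; ring
    have e0 : A5 ((N : ℤ) + 4 - 4) = pfS N := by
      rw [← A5_eq]; congr 1; ring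
    rw [e4, e3, e2, e1, e0]
    push_cast
    linear_combination pf_main N
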